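/- arXiv:1310.7984 — 2 statements merged into one kernel-verified Lean document; each statement's English description precedes it below -/
import Mathlib

section
/- Let G be a finite simple connected graph on vertex set {1,...,n} and G* its whisker graph, with edge ideal I(G*) in the polynomial ring S* = K[x_1,...,x_n,y_1,...,y_n] over a field K. Then depth(S*/I(G*)^k) ≤ n - k + 1 for all k = 1,...,n. -/
open MvPolynomial

/-- The depth of the module `M` with respect to the ideal `m`: the supremum of the
lengths of `M`-regular sequences consisting of elements of `m`. -/
noncomputable def idealDepth {R : Type*} [CommRing R] (m : Ideal R)
    (M : Type*) [AddCommGroup M] [Module R M] : ℕ :=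
  sSup {d : ℕ | ∃ rs : List R, rs.length = d ∧ (∀ r ∈ rs, r ∈ m) ∧
    RingTheory.Sequence.IsRegular M rs}

/-- The graded maximal ideal of a polynomial ring, generated by all the variables. -/
noncomputable def maxIdeal (σ K : Type*) [Field K] : Ideal (MvPolynomial σ K) :=
  Ideal.span (Set.range X)

/-- The edge ideal of the whisker graph `G*` of a graph `G` on `{1,…,n}`, inside
`S* = K[x_1,…,x_n,y_1,…,y_n]`, where `x_i = X (Sum.inl i)` and `y_i = X (Sum.inr i)`.
It is generated by `x_i x_j` for edges `{i,j}` of `G` and by `x_i y_i` for all `i`. -/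
noncomputable def whiskerEdgeIdeal {n : ℕ} (K : Type*) [Field K] (G : SimpleGraph (Fin n)) :
    Ideal (MvPolynomial (Fin n ⊕ Fin n) K) :=
  Ideal.span ({p | ∃ i j, G.Adj i j ∧ p = X (Sum.inl i) * X (Sum.inl j)} ∪
    Set.range (fun i : Fin n => X (Sum.inl i) * X (Sum.inr i)))

open CategoryTheory Abelian

section Ext

universe u

variable {R : Type u} [CommRing R]

/-- A form of Nakayama's lemma: if `s • E ⊆ y • E` with `s ∉ m` and `y ∈ m`, then the finite
module `E` vanishes locally at the prime `m`. -/
lemma annihilator_not_le_of_smul_eq_smul {E : Type*} [AddCommGroup E] [Module R E]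
    [Module.Finite R E] (m : Ideal R) [m.IsPrime] {s y : R} (hs : s ∉ m) (hy : y ∈ m)
    (h : ∀ e : E, ∃ e' : E, s • e = y • e') : ¬ Module.annihilator R E ≤ m := by
  intro hle
  have hE : (⟨m, inferInstance⟩ : PrimeSpectrum R) ∈ Module.support R E :=
    Module.mem_support_iff_of_finite.mpr hle
  have hq : (⟨m, inferInstance⟩ : PrimeSpectrum R) ∈ Module.support R (QuotSMulTop y E) := by
    rw [Module.support_quotSMulTop]
    exact ⟨hE, by simpa using hy⟩
  refine hs (Module.mem_support_iff_of_finite.mp hq (Module.mem_annihilator.mpr fun q ↦ ?_))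
  obtain ⟨e, rfl⟩ := Submodule.mkQ_surjective _ q
  obtain ⟨e', he'⟩ := h e
  rw [← map_smul, he']
  exact (Submodule.Quotient.mk_eq_zero _).mpr (Submodule.smul_mem_pointwise_smul _ _ _ trivial)

/-- Local vanishing of `Ext` passes from `R ⧸ (P + (y))` to `R ⧸ P`, one degree lower, when `y` is
regular modulo `P`. -/
lemma annihilator_ext_quotient_not_le [IsNoetherianRing R] (m : Ideal R) [m.IsPrime]
    (M : ModuleCat.{u} R) [Module.Finite R M] {P Q : Ideal R} {y : R} (hy : y ∈ m)
    (hQ : Q = P ⊔ Ideal.span {y}) (hreg : ∀ r, y * r ∈ P → r ∈ P) (i : ℕ)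
    (h : ¬ Module.annihilator R (Ext (ModuleCat.of R (R ⧸ Q)) M (i + 1)) ≤ m) :
    ¬ Module.annihilator R (Ext (ModuleCat.of R (R ⧸ P)) M i) ≤ m := by
  have hPQ : P ≤ Q := hQ ▸ le_sup_left
  let f : (R ⧸ P) →ₗ[R] (R ⧸ P) := LinearMap.lsmul R _ y
  let g : (R ⧸ P) →ₗ[R] (R ⧸ Q) := Submodule.factor hPQ
  have hfg : Function.Exact f g := by
    intro q
    obtain ⟨r, rfl⟩ := Submodule.mkQ_surjective _ q
    constructor
    · intro hr
      have hr : r ∈ Q := (Submodule.Quotient.mk_eq_zero _).mp hr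
      rw [hQ, Submodule.mem_sup] at hr
      obtain ⟨p, hp, z, hz, rfl⟩ := hr
      obtain ⟨c, rfl⟩ := Ideal.mem_span_singleton'.mp hz
      refine ⟨Submodule.mkQ _ c, ?_⟩
      refine (Submodule.Quotient.eq _).mpr ?_
      have : y • c - (p + c * y) = -p := by rw [smul_eq_mul]; ring
      rw [this]
      exact P.neg_mem hp
    · rintro ⟨q, hq⟩
      obtain ⟨c, rfl⟩ := Submodule.mkQ_surjective _ q
      rw [← hq]
      refine (Submodule.Quotient.mk_eq_zero _).mpr ?_
      rw [hQ]
      exact Ideal.mem_sup_right (Ideal.mem_span_singleton.mpr ⟨c, rfl⟩)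
  have hf : Function.Injective f := by
    rw [injective_iff_map_eq_zero]
    intro q hq
    obtain ⟨c, rfl⟩ := Submodule.mkQ_surjective _ q
    exact (Submodule.Quotient.mk_eq_zero _).mpr
      (hreg c ((Submodule.Quotient.mk_eq_zero _).mp hq))
  have hg : Function.Surjective g := Submodule.factor_surjective hPQ
  let S : ShortComplex (ModuleCat.{u} R) := ShortComplex.mk (ModuleCat.ofHom f) (ModuleCat.ofHom g)
    (by rw [← ModuleCat.ofHom_comp, hfg.linearMap_comp_eq_zero]; rfl)
  have hS : S.ShortExact := ModuleCat.shortComplex_shortExact S hfg hf hg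
  obtain ⟨s, hs, hsm⟩ := SetLike.not_le_iff_exists.mp h
  refine annihilator_not_le_of_smul_eq_smul m hsm hy fun e ↦ ?_
  obtain ⟨e', he'⟩ := Ext.contravariant_sequence_exact₁ hS M (s • e) (add_comm 1 i) (by
    rw [Ext.comp_smul]
    exact Module.mem_annihilator.mp hs _)
  refine ⟨e', he'.symm.trans ?_⟩
  have : S.f = y • 𝟙 _ := by ext; rfl
  rw [this, Ext.mk₀_smul, Ext.smul_comp]
  simp

/-- An element annihilating `Ext¹(R ⧸ P, M)` makes every linear map `P → M` extend to `R`. -/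
lemma exists_smul_eq_smul_of_mem_annihilator_ext (P : Ideal R) (M : ModuleCat.{u} R) {s : R}
    (hs : s ∈ Module.annihilator R (Ext (ModuleCat.of R (R ⧸ P)) M 1)) (φ : P →ₗ[R] M) :
    ∃ w : M, ∀ p : P, (p : R) • w = s • φ p := by
  let S : ShortComplex (ModuleCat.{u} R) := ShortComplex.mk
    (ModuleCat.ofHom P.subtype) (ModuleCat.ofHom P.mkQ)
    (by ext p; exact (Submodule.Quotient.mk_eq_zero _).mpr p.2)
  have hS : S.ShortExact := ModuleCat.shortComplex_shortExact S
    (LinearMap.exact_subtype_mkQ P) P.subtype_injective P.mkQ_surjective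
  obtain ⟨e, he⟩ := Ext.contravariant_sequence_exact₁ hS M
    (s • Ext.mk₀ (ModuleCat.ofHom φ : S.X₁ ⟶ M)) (add_zero 1) (by
      rw [Ext.comp_smul]
      exact Module.mem_annihilator.mp hs _)
  obtain ⟨ψ, rfl⟩ := Ext.addEquiv₀.symm.surjective e
  change (Ext.mk₀ S.f).comp (Ext.mk₀ ψ) _ = _ at he
  rw [Ext.mk₀_comp_mk₀, ← Ext.mk₀_smul] at he
  have he := Ext.mk₀_bijective _ _ |>.injective he
  refine ⟨ψ.hom (1 : R), fun p ↦ ?_⟩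
  rw [← map_smul]
  have := congrArg (fun χ ↦ χ.hom p) he
  simpa [S] using this

end Ext

section Polynomial

universe u v

variable {σ : Type v} {K : Type u} [Field K]

lemma mem_maxIdeal_iff {p : MvPolynomial σ K} : p ∈ maxIdeal σ K ↔ coeff 0 p = 0 := by
  rw [maxIdeal, ← Set.image_univ, mem_ideal_span_X_image]
  constructor
  · intro h
    by_contra h0
    obtain ⟨i, -, hi⟩ := h 0 (mem_support_iff.mpr h0)
    exact hi rfl
  · intro h d hd
    have hd0 : d ≠ 0 := by
      rintro rfl
      exact mem_support_iff.mp hd h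
    obtain ⟨i, hi⟩ := DFunLike.ne_iff.mp hd0
    exact ⟨i, trivial, hi⟩

instance maxIdeal_isPrime : (maxIdeal σ K).IsPrime := by
  have : maxIdeal σ K = RingHom.ker (constantCoeff (σ := σ) (R := K)) := by
    ext p
    rw [mem_maxIdeal_iff, RingHom.mem_ker, constantCoeff_eq]
  rw [this]
  exact RingHom.ker_isPrime _

lemma mem_span_X_image_of_X_mul_mem {s : Set σ} {j : σ} (hj : j ∉ s) {p : MvPolynomial σ K}
    (h : X j * p ∈ Ideal.span (X '' s : Set (MvPolynomial σ K))) :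
    p ∈ Ideal.span (X '' s : Set (MvPolynomial σ K)) := by
  rw [mem_ideal_span_X_image] at h ⊢
  intro d hd
  obtain ⟨i, hi, hne⟩ := h (Finsupp.single j 1 + d) (by
    rw [mem_support_iff, coeff_X_mul]
    exact mem_support_iff.mp hd)
  refine ⟨i, hi, ?_⟩
  have hij : j ≠ i := fun h ↦ hj (h ▸ hi)
  simpa [Finsupp.single_apply, hij] using hne

/-- If `u` is annihilated, modulo `I`, by all products of a variable in `A` with a variable in the
disjoint set `B`, then it is annihilated by the intersection of the two ideals they generate. -/
lemma mul_mem_of_mem_inf_span_X {I : Ideal (MvPolynomial σ K)} {A B : Set σ} (hAB : Disjoint A B)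
    {u : MvPolynomial σ K} (hu : ∀ a ∈ A, ∀ b ∈ B, X a * X b * u ∈ I) {p : MvPolynomial σ K}
    (hA : p ∈ Ideal.span (X '' A : Set (MvPolynomial σ K)))
    (hB : p ∈ Ideal.span (X '' B : Set (MvPolynomial σ K))) : p * u ∈ I := by
  rw [mem_ideal_span_X_image] at hA hB
  rw [p.as_sum, Finset.sum_mul]
  refine Ideal.sum_mem _ fun d hd ↦ ?_
  obtain ⟨a, ha, hda⟩ := hA d hd
  obtain ⟨b, hb, hdb⟩ := hB d hd
  have hab : a ≠ b := fun h ↦ hAB.notMem_of_mem_left ha (h ▸ hb)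
  have hle : Finsupp.single a 1 + Finsupp.single b 1 ≤ d := by
    intro i
    by_cases hia : a = i
    · subst hia
      simp [hab.symm]
      lia
    · by_cases hib : b = i
      · subst hib
        simp [hab]
        lia
      · simp [hia, hib]
  have : monomial d (coeff d p) * u =
      monomial (d - (Finsupp.single a 1 + Finsupp.single b 1)) (coeff d p) * (X a * X b * u) := by
    rw [X, X, ← mul_assoc, ← mul_assoc, monomial_mul, monomial_mul, mul_one, mul_one, add_assoc,
      tsub_add_cancel_of_le hle]
  rw [this]
  exact I.mul_mem_left _ (hu a ha b hb)

end Polynomial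

section Depth

universe u

variable {σ : Type} [Finite σ] {K : Type u} [Field K]

/-- If `R ⧸ I` has a regular sequence of length `d`, then `Extⁱ(K[t], R ⧸ I)` vanishes locally at
the origin for `i + |t| < d`, where `K[t]` is the quotient by the variables outside `t`. -/
lemma annihilator_ext_not_le_of_isRegular (M : ModuleCat.{u} (MvPolynomial σ K))
    [Module.Finite (MvPolynomial σ K) M]
    (hM : maxIdeal σ K • (⊤ : Submodule (MvPolynomial σ K) M) < ⊤)
    (rs : List (MvPolynomial σ K)) (hrs : ∀ r ∈ rs, r ∈ maxIdeal σ K)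
    (hreg : RingTheory.Sequence.IsRegular M rs) (t : Finset σ) (i : ℕ)
    (hi : i + t.card < rs.length) :
    ¬ Module.annihilator (MvPolynomial σ K)
      (Ext (ModuleCat.of _ (MvPolynomial σ K ⧸
        Ideal.span (X '' (↑t : Set σ)ᶜ : Set (MvPolynomial σ K)))) M i) ≤ maxIdeal σ K := by
  classical
  induction t using Finset.induction generalizing i with
  | empty =>
    have hsub := ModuleCat.subsingleton_ext_of_exists_isRegular (maxIdeal σ K)
      (ModuleCat.of _ (MvPolynomial σ K ⧸ Ideal.span
        (X '' (↑(∅ : Finset σ) : Set σ)ᶜ : Set (MvPolynomial σ K)))) (by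
          rw [Module.support_eq_zeroLocus]
          refine PrimeSpectrum.zeroLocus_anti_mono ?_
          simp [Ideal.annihilator_quotient, maxIdeal])
      M hM rs hrs hreg i (by simpa using hi)
    rw [Module.annihilator_eq_top_iff.mpr hsub, top_le_iff]
    exact maxIdeal_isPrime.ne_top
  | insert j t hj ih =>
    rw [Finset.card_insert_of_notMem hj] at hi
    refine annihilator_ext_quotient_not_le (maxIdeal σ K) M (y := X j)
      (Ideal.subset_span ⟨j, rfl⟩) ?_ (fun p hp ↦ mem_span_X_image_of_X_mul_mem (by simp) hp) i
      (ih (i + 1) (by lia))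
    rw [← Ideal.span_union, ← Set.image_singleton, ← Set.image_union]
    congr 2
    ext x
    by_cases hx : x = j <;> simp [hx, hj]

/-- A depth bound: a monomial `u` whose annihilator modulo `I` disconnects the variables outside
`t` into two parts `A` and `B` bounds the depth of the quotient by `I` by `|t| + 1`. -/
theorem length_le_card_add_one_of_isRegular {I : Ideal (MvPolynomial σ K)} {A B : Set σ}
    (hAB : Disjoint A B) (t : Finset σ) (ht : A ∪ B = (↑t : Set σ)ᶜ) (d : σ →₀ ℕ)
    (hd : ∀ a ∈ A, ∀ b ∈ B, X a * X b * monomial d (1 : K) ∈ I) {a b : σ} (ha : a ∈ A) (hb : b ∈ B)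
    (hIa : ∀ p ∈ I, coeff (Finsupp.single a 1 + d) p = 0)
    (hIb : ∀ p ∈ I, coeff (Finsupp.single b 1 + d) p = 0)
    {rs : List (MvPolynomial σ K)} (hrs : ∀ r ∈ rs, r ∈ maxIdeal σ K)
    (hreg : RingTheory.Sequence.IsRegular (MvPolynomial σ K ⧸ I) rs) :
    rs.length ≤ t.card + 1 := by
  by_contra! hlen
  have hIm : I ≤ maxIdeal σ K := by
    intro p hp
    have := hIa _ (I.mul_mem_left (monomial (Finsupp.single a 1 + d) 1) hp)
    rw [mem_maxIdeal_iff]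
    simpa [coeff_monomial_mul'] using this
  have hM : maxIdeal σ K • (⊤ : Submodule (MvPolynomial σ K) (MvPolynomial σ K ⧸ I)) < ⊤ := by
    rw [lt_top_iff_ne_top]
    intro h
    have h1 := congrArg (Submodule.comap I.mkQ) h
    rw [Submodule.comap_smul_top_of_surjective _ _ I.mkQ_surjective] at h1
    simp only [Submodule.comap_top, Submodule.ker_mkQ, smul_eq_mul, Ideal.mul_top] at h1
    rw [sup_eq_left.mpr hIm] at h1
    exact maxIdeal_isPrime.ne_top h1
  obtain ⟨s, hs, hsm⟩ := SetLike.not_le_iff_exists.mp <|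
    annihilator_ext_not_le_of_isRegular (ModuleCat.of _ (MvPolynomial σ K ⧸ I)) hM rs hrs hreg t 1
      (by lia)
  let JA : Ideal (MvPolynomial σ K) := Ideal.span (X '' A)
  let JB : Ideal (MvPolynomial σ K) := Ideal.span (X '' B)
  let u : MvPolynomial σ K ⧸ I := I.mkQ (monomial d 1)
  let φA : MvPolynomial σ K →ₗ.[MvPolynomial σ K] (MvPolynomial σ K ⧸ I) := ⟨JA, 0⟩
  let φB : MvPolynomial σ K →ₗ.[MvPolynomial σ K] (MvPolynomial σ K ⧸ I) :=
    ⟨JB, (LinearMap.toSpanSingleton _ _ u).comp JB.subtype⟩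
  have hφ : ∀ (x : φA.domain) (y : φB.domain), (x : MvPolynomial σ K) = y → φA x = φB y := by
    rintro ⟨x, hx⟩ ⟨y, hy⟩ (rfl : x = y)
    exact ((Submodule.Quotient.mk_eq_zero _).mpr (mul_mem_of_mem_inf_span_X hAB hd hx hy)).symm
  have hdom : JA ⊔ JB = Ideal.span (X '' (↑t : Set σ)ᶜ : Set (MvPolynomial σ K)) := by
    rw [← Ideal.span_union, ← Set.image_union, ht]
  rw [← hdom] at hs
  obtain ⟨w, hw⟩ := exists_smul_eq_smul_of_mem_annihilator_ext _ _ hs (φA.sup φB hφ).toFun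
  obtain ⟨w, rfl⟩ := I.mkQ_surjective w
  have hXa : X a ∈ JA := Ideal.subset_span ⟨a, ha, rfl⟩
  have hXb : X b ∈ JB := Ideal.subset_span ⟨b, hb, rfl⟩
  have hwa : X a * w ∈ I := by
    have h1 := hw ⟨X a, Ideal.mem_sup_left hXa⟩
    have h2 := LinearPMap.sup_apply hφ ⟨X a, hXa⟩ 0 ⟨X a, Ideal.mem_sup_left hXa⟩ (by simp)
    refine (Submodule.Quotient.mk_eq_zero _).mp (h1.trans ?_)
    refine (congrArg (s • ·) h2).trans ?_
    simp [φA]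
  have hwb : X b * w - s * (X b * monomial d 1) ∈ I := by
    have h1 := hw ⟨X b, Ideal.mem_sup_right hXb⟩
    have h2 := LinearPMap.sup_apply hφ 0 ⟨X b, hXb⟩ ⟨X b, Ideal.mem_sup_right hXb⟩ (by simp)
    refine (Submodule.Quotient.eq _).mp (h1.trans ?_)
    refine (congrArg (s • ·) h2).trans ?_
    rw [φA.map_zero, zero_add]
    rfl
  have h1 := hIa _ hwa
  have h2 := hIb _ hwb
  rw [coeff_X_mul] at h1
  rw [coeff_sub, coeff_X_mul, h1, zero_sub, neg_eq_zero, X, monomial_mul, mul_one,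
    coeff_mul_monomial'] at h2
  exact hsm (mem_maxIdeal_iff.mpr (by simpa using h2))

end Depth

section Weight

variable {σ R : Type*} [CommSemiring R]

/-- The ideal of polynomials all of whose monomials have `w`-weight at least `m`. -/
def weightIdeal (w : σ → ℕ) (m : ℕ) : Ideal (MvPolynomial σ R) where
  carrier := {p | ∀ d, Finsupp.weight w d < m → coeff d p = 0}
  add_mem' hp hq d hd := by rw [coeff_add, hp d hd, hq d hd, add_zero]
  zero_mem' d _ := coeff_zero d
  smul_mem' r p hp d hd := by
    classical
    rw [smul_eq_mul, coeff_mul]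
    refine Finset.sum_eq_zero fun e he ↦ ?_
    rw [← Finset.HasAntidiagonal.mem_antidiagonal.mp he, map_add] at hd
    rw [hp e.2 (by lia), mul_zero]

lemma weightIdeal_mul_le (w : σ → ℕ) (m m' : ℕ) :
    (weightIdeal w m * weightIdeal w m' : Ideal (MvPolynomial σ R)) ≤ weightIdeal w (m + m') := by
  classical
  refine Ideal.mul_le.mpr fun p hp q hq d hd ↦ ?_
  rw [coeff_mul]
  refine Finset.sum_eq_zero fun e he ↦ ?_
  rw [← Finset.HasAntidiagonal.mem_antidiagonal.mp he, map_add] at hd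
  by_cases h : Finsupp.weight w e.1 < m
  · rw [hp e.1 h, zero_mul]
  · rw [hq e.2 (by lia), mul_zero]

lemma pow_le_weightIdeal {w : σ → ℕ} {m : ℕ} {I : Ideal (MvPolynomial σ R)}
    (h : I ≤ weightIdeal w m) (k : ℕ) : I ^ k ≤ weightIdeal w (m * k) := by
  induction k with
  | zero => exact fun p _ d hd ↦ by simp at hd
  | succ k ih =>
    rw [pow_succ, Nat.mul_succ]
    exact (Ideal.mul_mono ih h).trans (weightIdeal_mul_le w _ _)

lemma X_mul_X_mem_weightIdeal {w : σ → ℕ} {m : ℕ} {i j : σ} (h : m ≤ w i + w j) :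
    (X i * X j : MvPolynomial σ R) ∈ weightIdeal w m := by
  classical
  intro d hd
  rw [X, X, monomial_mul, coeff_monomial, if_neg]
  rintro rfl
  simp [Finsupp.weight_single] at hd
  lia

end Weight

section Tree

variable {V S : Type*} [CommRing S]

/-- The alternating-path property of the product `f` of the `m` edges of a tree with vertex set `T`
and proper 2-colouring `c`: multiplying `f` by two factors sitting at the ends of an alternating
path produces an element of `I ^ (m + 1)`. -/
structure IsAlternating (I : Ideal S) (x : V → S) (T : Set V) (c : V → Bool) (f : S) (m : ℕ) :
    Prop where
  mem : f ∈ I ^ m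
  mul_mul_mem : ∀ s ∈ T, ∀ t ∈ T, c s ≠ c t → ∀ α β, α * x s ∈ I → β * x t ∈ I →
    α * β * f ∈ I ^ (m + 1)
  vertex_mul_mem : ∀ s ∈ T, ∀ t ∈ T, c s = c t → ∀ β, β * x t ∈ I → x s * β * f ∈ I ^ (m + 1)
  vertex_vertex_mem : ∀ s ∈ T, ∀ t ∈ T, c s ≠ c t → x s * x t * f ∈ I ^ (m + 1)

lemma IsAlternating.singleton (I : Ideal S) (x : V → S) (v : V) (c : V → Bool) :
    IsAlternating I x {v} c 1 0 where
  mem := by simp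
  mul_mul_mem := by
    rintro s rfl t rfl h
    exact absurd rfl h
  vertex_mul_mem := by
    rintro s rfl t rfl - β hβ
    simpa [mul_comm] using hβ
  vertex_vertex_mem := by
    rintro s rfl t rfl h
    exact absurd rfl h

/-- The alternating-path property persists when a leaf `l` is attached to the tree at `v`. -/
lemma IsAlternating.insert {I : Ideal S} {x : V → S} {T : Set V} {c : V → Bool} {f : S} {m : ℕ}
    (h : IsAlternating I x T c f m) {v l : V} (hv : v ∈ T) (hvl : x v * x l ∈ I)
    (hc : c l ≠ c v) :
    IsAlternating I x (insert l T) c (x v * x l * f) (m + 1) := by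
  have hlv : x l * x v ∈ I := mul_comm (x v) (x l) ▸ hvl
  have key {a b y : S} (ha : a ∈ I) (hb : b ∈ I ^ (m + 1)) (hy : y = a * b) :
      y ∈ I ^ (m + 1 + 1) := by
    rw [hy, pow_succ' I (m + 1)]
    exact Ideal.mul_mem_mul ha hb
  have hmem : ∀ a ∈ I, a * f ∈ I ^ (m + 1) := fun a ha ↦ by
    rw [pow_succ']
    exact Ideal.mul_mem_mul ha h.mem
  have hbool : ∀ {a b d : Bool}, a ≠ b → a ≠ d → b = d := by decide
  refine ⟨hmem _ hvl, ?_, ?_, ?_⟩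
  · rintro s (rfl | hs) t (rfl | ht) hst α β hα hβ
    · exact absurd rfl hst
    · exact key hα (h.vertex_mul_mem v hv t ht (hbool hc hst) β hβ) (by ring)
    · exact key hβ (h.vertex_mul_mem v hv s hs (hbool hc hst.symm) α hα) (by ring)
    · exact key hvl (h.mul_mul_mem s hs t ht hst α β hα hβ) (by ring)
  · rintro s (rfl | hs) t (rfl | ht) hst β hβ
    · exact key hβ (hmem _ hvl) (by ring)
    · exact key hvl (h.mul_mul_mem v hv t ht (hst ▸ hc.symm) (x s) β hlv hβ) (by ring)
    · exact key hβ (h.vertex_vertex_mem s hs v hv (hst ▸ hc)) (by ring)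
    · exact key hvl (h.vertex_mul_mem s hs t ht hst β hβ) (by ring)
  · rintro s (rfl | hs) t (rfl | ht) hst
    · exact absurd rfl hst
    · exact key hvl (h.vertex_mul_mem t ht v hv (hbool hst hc) (x s) hlv) (by ring)
    · exact key hvl (h.vertex_mul_mem s hs v hv (hbool hst.symm hc) (x t) hlv) (by ring)
    · exact key hvl (h.vertex_vertex_mem s hs t ht hst) (by ring)

lemma IsAlternating.congr {I : Ideal S} {x : V → S} {T : Set V} {c c' : V → Bool} {f : S} {m : ℕ}
    (h : IsAlternating I x T c f m) (hc : Set.EqOn c c' T) : IsAlternating I x T c' f m where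
  mem := h.mem
  mul_mul_mem s hs t ht hst := h.mul_mul_mem s hs t ht (by rwa [hc hs, hc ht])
  vertex_mul_mem s hs t ht hst := h.vertex_mul_mem s hs t ht (by rwa [hc hs, hc ht])
  vertex_vertex_mem s hs t ht hst := h.vertex_vertex_mem s hs t ht (by rwa [hc hs, hc ht])

end Tree

section Whisker

variable {n : ℕ} {K : Type*} [Field K] {G : SimpleGraph (Fin n)}

lemma X_mul_X_mem_whiskerEdgeIdeal {i j : Fin n} (h : G.Adj i j) :
    (X (Sum.inl i) * X (Sum.inl j)) ∈ whiskerEdgeIdeal K G :=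
  Ideal.subset_span (Or.inl ⟨i, j, h, rfl⟩)

lemma X_mul_Y_mem_whiskerEdgeIdeal (i : Fin n) :
    (X (Sum.inl i) * X (Sum.inr i)) ∈ whiskerEdgeIdeal K G :=
  Ideal.subset_span (Or.inr ⟨i, rfl⟩)

/-- In a connected graph there are subtrees with any number `m + 1 ≤ n` of vertices; `d` is the
exponent of the product of the edges of the tree. -/
lemma exists_isAlternating (hG : G.Connected) (m : ℕ) (hm : m < n) :
    ∃ (T : Finset (Fin n)) (c : Fin n → Bool) (d : Fin n ⊕ Fin n →₀ ℕ), T.card = m + 1 ∧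
      (∀ z ∉ Sum.inl '' (T : Set (Fin n)), d z = 0) ∧ d.degree = 2 * m ∧
      IsAlternating (whiskerEdgeIdeal K G) (fun i ↦ X (Sum.inl i)) T c (monomial d 1) m := by
  induction m with
  | zero =>
    refine ⟨{⟨0, hm⟩}, fun _ ↦ true, 0, by simp, by simp, by simp, ?_⟩
    simpa using IsAlternating.singleton _ _ _ _
  | succ m ih =>
    obtain ⟨T, c, d, hT, hd, hdeg, hf⟩ := ih (by lia)
    obtain ⟨a, ha⟩ : T.Nonempty := Finset.card_pos.mp (by lia)
    obtain ⟨b, hb⟩ : ∃ b, b ∉ T := by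
      by_contra! h
      have := Finset.card_eq_of_equiv_fin (Equiv.refl _ |>.trans
        (Equiv.subtypeUnivEquiv h))
      lia
    obtain ⟨p⟩ := hG.preconnected a b
    obtain ⟨⟨⟨v, l⟩, hvl⟩, -, hv, hl⟩ := p.exists_boundary_dart (T : Set (Fin n)) ha hb
    have hl' : l ∉ T := hl
    refine ⟨insert l T, Function.update c l (!c v),
      Finsupp.single (Sum.inl v) 1 + Finsupp.single (Sum.inl l) 1 + d,
      by rw [Finset.card_insert_of_notMem hl', hT], ?_, ?_, ?_⟩
    · intro z hz
      have hzv : Sum.inl v ≠ z := by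
        rintro rfl
        exact hz ⟨v, by simpa using Or.inr hv, rfl⟩
      have hzl : Sum.inl l ≠ z := by
        rintro rfl
        exact hz ⟨l, by simp, rfl⟩
      have hzd : d z = 0 := hd z fun ⟨i, hi, h⟩ ↦ hz ⟨i, by simpa using Or.inr hi, h⟩
      simp [hzv, hzl, hzd]
    · simp [hdeg]
      lia
    · have hf' := (hf.congr (c' := Function.update c l (!c v)) fun i hi ↦ by
        rw [Function.update_of_ne]
        rintro rfl
        exact hl hi).insert hv (l := l) (X_mul_X_mem_whiskerEdgeIdeal hvl) (by
          rw [Function.update_self, Function.update_of_ne hvl.ne]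
          simp)
      simpa [X, monomial_mul] using hf'

end Whisker

/-- Herzog–Hibi–Qureshi, Theorem (whisker): if `G` is a finite simple connected graph
on `n` vertices, then `depth(S*/I(G*)^k) ≤ n - k + 1` for `k = 1, …, n`. -/
theorem depth_whisker_power_le {n : ℕ} (K : Type*) [Field K] (G : SimpleGraph (Fin n))
    (hG : G.Connected) (k : ℕ) (hk1 : 1 ≤ k) (hkn : k ≤ n) :
    idealDepth (maxIdeal (Fin n ⊕ Fin n) K)
      (MvPolynomial (Fin n ⊕ Fin n) K ⧸ (whiskerEdgeIdeal K G) ^ k) ≤ n - k + 1 := by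
  obtain ⟨m, rfl⟩ : ∃ m, k = m + 1 := ⟨k - 1, by lia⟩
  refine csSup_le' ?_
  rintro _ ⟨rs, rfl, hrs, hreg⟩
  obtain ⟨T, c, d, hT, hd, hdeg, hf⟩ := exists_isAlternating (K := K) hG m (by lia)
  let I := whiskerEdgeIdeal K G
  let e : Fin n ⊕ Fin n →₀ ℕ := ∑ i ∈ Tᶜ, Finsupp.single (Sum.inr i) 1
  let side (b : Bool) : Set (Fin n ⊕ Fin n) :=
    {z | Sum.elim (fun i ↦ i ∈ T ∧ c i = b) (fun i ↦ i ∈ T ∧ c i = !b) z}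
  let A := side true
  let B : Set (Fin n ⊕ Fin n) := side false ∪ Sum.inl '' (T : Set (Fin n))ᶜ
  have hAB : Disjoint A B := by
    rw [Set.disjoint_left]
    rintro (i | i) ⟨hi, hA⟩ (⟨-, hB⟩ | ⟨j, hj, hji⟩)
    · simp [hA] at hB
    · exact hj (Sum.inl_injective hji ▸ hi)
    · simp [hA] at hB
    · exact absurd hji (by simp)
  let w : Fin n ⊕ Fin n → ℕ := Sum.elim (fun i ↦ if i ∈ T then 1 else 2)
    (fun i ↦ if i ∈ T then 1 else 0)
  have hw : I ^ (m + 1) ≤ weightIdeal w (2 * (m + 1)) := by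
    refine pow_le_weightIdeal (Ideal.span_le.mpr ?_) _
    rintro _ (⟨i, j, -, rfl⟩ | ⟨i, rfl⟩)
    · refine X_mul_X_mem_weightIdeal ?_
      simp only [w, Sum.elim_inl]
      split_ifs <;> lia
    · refine X_mul_X_mem_weightIdeal ?_
      simp only [w, Sum.elim_inl, Sum.elim_inr]
      split_ifs <;> lia
  have hwd : Finsupp.weight w (d + e) = 2 * m := by
    have hwe : Finsupp.weight w e = 0 := by
      simp only [e, map_sum]
      refine Finset.sum_eq_zero fun i hi ↦ ?_
      simp [w, Finsupp.weight_single, Finset.mem_compl.mp hi]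
    rw [map_add, hwe, add_zero, ← hdeg, Finsupp.weight_apply, Finsupp.degree_apply]
    refine Finset.sum_congr rfl fun z hz ↦ ?_
    obtain ⟨i, hi, rfl⟩ : z ∈ Sum.inl '' (T : Set (Fin n)) := by
      by_contra h
      exact Finsupp.mem_support_iff.mp hz (hd z h)
    simp [w, Finset.mem_coe.mp hi]
  have hcoeff (b : Bool) (z) (hz : z ∈ side b) (p) (hp : p ∈ I ^ (m + 1)) :
      coeff (Finsupp.single z 1 + (d + e)) p = 0 := by
    refine hw hp _ ?_
    have : w z = 1 := by
      obtain i | i := z <;> exact if_pos hz.1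
    rw [map_add, hwd, Finsupp.weight_single, this, smul_eq_mul]
    lia
  have hmul : ∀ a ∈ A, ∀ b ∈ B, X a * X b * monomial (d + e) (1 : K) ∈ I ^ (m + 1) := by
    have hy (i : Fin n) : (X (Sum.inr i) * X (Sum.inl i) : MvPolynomial _ K) ∈ I := by
      rw [mul_comm]
      exact X_mul_Y_mem_whiskerEdgeIdeal i
    have hde : monomial (d + e) (1 : K) = monomial d 1 * monomial e 1 := by
      rw [monomial_mul, one_mul]
    rintro a ha b (hb | ⟨i, hi, rfl⟩)
    · rw [hde, ← mul_assoc]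
      refine Ideal.mul_mem_right _ _ ?_
      obtain a | a := a <;> obtain b | b := b <;> obtain ⟨haT, hac⟩ := ha <;>
        obtain ⟨hbT, hbc⟩ := hb
      · exact hf.vertex_vertex_mem a haT b hbT (by simp [hac, hbc])
      · exact hf.vertex_mul_mem a haT b hbT (by simp [hac, hbc]) _ (hy b)
      · rw [mul_comm (X _)]
        exact hf.vertex_mul_mem b hbT a haT (by simp [hac, hbc]) _ (hy a)
      · exact hf.mul_mul_mem a haT b hbT (by simp [hac, hbc]) _ _ (hy a) (hy b)
    · obtain ⟨e', he'⟩ := exists_add_of_le <| show Finsupp.single (Sum.inr i) 1 ≤ e from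
        Finset.single_le_sum_of_canonicallyOrdered
          (f := fun i ↦ (Finsupp.single (Sum.inr i) 1 : Fin n ⊕ Fin n →₀ ℕ))
          (Finset.mem_compl.mpr hi)
      have hsplit : X a * X (Sum.inl i) * monomial (d + e) (1 : K) =
          X a * monomial e' 1 * (monomial d 1 * (X (Sum.inl i) * X (Sum.inr i))) := by
        rw [hde, he', ← one_mul (1 : K), ← monomial_mul, one_mul, ← X]
        ring
      rw [hsplit, pow_succ]
      exact Ideal.mul_mem_left _ _
        (Ideal.mul_mem_mul hf.mem (X_mul_Y_mem_whiskerEdgeIdeal i))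
  obtain ⟨i, hi⟩ : T.Nonempty := Finset.card_pos.mp (by lia)
  have hside (b : Bool) : ∃ z, z ∈ side b := by
    by_cases h : c i = b
    · exact ⟨Sum.inl i, hi, h⟩
    · exact ⟨Sum.inr i, hi, Bool.eq_not.mpr h⟩
  obtain ⟨a, ha⟩ := hside true
  obtain ⟨b, hb⟩ := hside false
  have hunion : A ∪ B = (↑(Tᶜ.map (Function.Embedding.inr : Fin n ↪ Fin n ⊕ Fin n)) :
      Set (Fin n ⊕ Fin n))ᶜ := by
    ext (i | i)
    · by_cases hi : i ∈ T <;> cases hc : c i <;> simp [A, B, side, hi, hc]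
    · by_cases hi : i ∈ T <;> cases hc : c i <;> simp [A, B, side, hi, hc]
  have hlen := length_le_card_add_one_of_isRegular hAB (Tᶜ.map Function.Embedding.inr) hunion (d + e) hmul ha (Or.inl hb)
    (hcoeff _ a ha) (hcoeff _ b hb) hrs hreg
  rwa [Finset.card_map, Finset.card_compl, hT, Fintype.card_fin] at hlen
end

section
/- Let G be a forest on n vertices and let I = I(G*) ⊆ S* = K[x_1,...,x_n,y_1,...,y_n] be the edge ideal of its whisker graph G*. Then depth(S*/I^k) ≥ n - k + 1 for k = 1,...,n. -/
open MvPolynomial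

section ExtDepth

universe u

open CategoryTheory RingTheory.Sequence Pointwise

variable {R : Type u} [CommRing R]

/-- `ExtDepthGE m d M` says that `Ext^i(R/m, M) = 0` for all `i < d`. -/
def ExtDepthGE (m : Ideal R) (d : ℕ) (M : Type u) [AddCommGroup M] [Module R M] : Prop :=
  ∀ i < d, Subsingleton (Abelian.Ext (ModuleCat.of R (R ⧸ m)) (ModuleCat.of R M) i)

variable {m : Ideal R} {d : ℕ}

/-- Multiplication by `f` as a map `R / C → R / J`, where `C = (J : f)`. -/
def Ideal.colonMap {J C : Ideal R} {f : R} (hC : ∀ g, g ∈ C ↔ f * g ∈ J) :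
    (R ⧸ C) →ₗ[R] (R ⧸ J) :=
  Submodule.mapQ C J (LinearMap.mulLeft R f) fun g hg => (hC g).mp hg

theorem Ideal.colonMap_injective {J C : Ideal R} {f : R} (hC : ∀ g, g ∈ C ↔ f * g ∈ J) :
    Function.Injective (Ideal.colonMap hC) := by
  rw [injective_iff_map_eq_zero]
  intro x hx
  obtain ⟨g, rfl⟩ := Submodule.Quotient.mk_surjective C x
  exact (Submodule.Quotient.mk_eq_zero C).mpr
    ((hC g).mpr ((Submodule.Quotient.mk_eq_zero J).mp hx))

theorem Ideal.exact_colonMap_factor {J C : Ideal R} {f : R} (hC : ∀ g, g ∈ C ↔ f * g ∈ J) :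
    Function.Exact (Ideal.colonMap hC)
      (Submodule.factor (le_sup_left : J ≤ J ⊔ Ideal.span {f})) := by
  intro x
  obtain ⟨g, rfl⟩ := Submodule.Quotient.mk_surjective J x
  constructor
  · intro hg
    obtain ⟨a, ha, b, hb, rfl⟩ := Submodule.mem_sup.mp ((Submodule.Quotient.mk_eq_zero _).mp hg)
    obtain ⟨c, rfl⟩ := Ideal.mem_span_singleton'.mp hb
    refine ⟨Submodule.Quotient.mk c, (Submodule.Quotient.eq J).mpr ?_⟩
    have hsub : f * c - (a + c * f) = -a := by ring
    exact (congrArg (· ∈ J) hsub).mpr (J.neg_mem ha)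
  · rintro ⟨y, hy⟩
    obtain ⟨c, rfl⟩ := Submodule.Quotient.mk_surjective C y
    rw [← hy]
    exact (Submodule.Quotient.mk_eq_zero _).mpr
      (Ideal.mem_sup_right (Ideal.mul_mem_right _ _ (Ideal.mem_span_singleton_self f)))

/-- The complex `R / (J : f) → R / J → R / (J + (f))`. -/
def Ideal.colonComplex {J C : Ideal R} {f : R} (hC : ∀ g, g ∈ C ↔ f * g ∈ J) :
    ShortComplex (ModuleCat.{u} R) :=
  ModuleCat.shortComplexOfCompEqZero (Ideal.colonMap hC)
    (Submodule.factor (le_sup_left : J ≤ J ⊔ Ideal.span {f}))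
    (Ideal.exact_colonMap_factor hC).linearMap_comp_eq_zero

theorem Ideal.colonComplex_shortExact {J C : Ideal R} {f : R} (hC : ∀ g, g ∈ C ↔ f * g ∈ J) :
    (Ideal.colonComplex hC).ShortExact where
  exact := ModuleCat.shortComplex_exact _ (Ideal.exact_colonMap_factor hC)
  mono_f := (ModuleCat.mono_iff_injective _).mpr (Ideal.colonMap_injective hC)
  epi_g := (ModuleCat.epi_iff_surjective _).mpr (Submodule.factor_surjective le_sup_left)

namespace ExtDepthGE

theorem mono {M : Type u} [AddCommGroup M] [Module R M] {e : ℕ} (h : ExtDepthGE m d M)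
    (hed : e ≤ d) : ExtDepthGE m e M :=
  fun i hi => h i (hi.trans_le hed)

theorem zero (M : Type u) [AddCommGroup M] [Module R M] : ExtDepthGE m 0 M :=
  fun i hi => absurd hi (Nat.not_lt_zero i)

theorem middle_of_shortExact {S : ShortComplex (ModuleCat.{u} R)} (hS : S.ShortExact)
    (h₁ : ExtDepthGE m d S.X₁) (h₃ : ExtDepthGE m d S.X₃) : ExtDepthGE m d S.X₂ := by
  refine fun i hi => subsingleton_of_forall_eq 0 fun x => ?_
  have := h₁ i hi
  have := h₃ i hi
  obtain ⟨y, rfl⟩ := Abelian.Ext.covariant_sequence_exact₂ _ hS x (Subsingleton.elim _ _)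
  rw [Subsingleton.elim y 0, Abelian.Ext.zero_comp]

theorem right_of_shortExact {S : ShortComplex (ModuleCat.{u} R)} (hS : S.ShortExact)
    (h₁ : ExtDepthGE m (d + 1) S.X₁) (h₂ : ExtDepthGE m d S.X₂) : ExtDepthGE m d S.X₃ := by
  refine fun i hi => subsingleton_of_forall_eq 0 fun x => ?_
  have := h₁ (i + 1) (by lia)
  have := h₂ i hi
  obtain ⟨y, rfl⟩ := Abelian.Ext.covariant_sequence_exact₃ _ hS x rfl (Subsingleton.elim _ _)
  rw [Subsingleton.elim y 0, Abelian.Ext.zero_comp]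

theorem quotient_top : ExtDepthGE m d (R ⧸ (⊤ : Ideal R)) := by
  intro i _
  refine subsingleton_of_forall_eq 0 fun x => ?_
  have h0 : 𝟙 (ModuleCat.of R (R ⧸ (⊤ : Ideal R))) = 0 := by
    ext
    exact Subsingleton.elim (α := R ⧸ (⊤ : Ideal R)) _ _
  rw [← Abelian.Ext.comp_mk₀_id x, h0, Abelian.Ext.mk₀_zero, Abelian.Ext.comp_zero]

/-- Vanishing of `Ext` produces a regular sequence. -/
theorem exists_isWeaklyRegular [IsNoetherianRing R] {M : Type u} [AddCommGroup M] [Module R M]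
    [Module.Finite R M] (h : ExtDepthGE m d M) :
    ∃ rs : List R, rs.length = d ∧ (∀ r ∈ rs, r ∈ m) ∧ IsWeaklyRegular M rs := by
  induction d generalizing M with
  | zero => exact ⟨[], rfl, by simp, .nil R M⟩
  | succ d ih =>
    have hhom : Subsingleton ((R ⧸ m) →ₗ[R] M) :=
      have := h 0 (Nat.succ_pos d)
      ((Abelian.Ext.homEquiv₀ (X := ModuleCat.of R (R ⧸ m)) (Y := ModuleCat.of R M)).trans
        ModuleCat.homEquiv).symm.subsingleton
    obtain ⟨r, hr, hreg⟩ := IsSMulRegular.subsingleton_linearMap_iff.mp hhom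
    rw [Ideal.annihilator_quotient] at hr
    have hS := IsSMulRegular.smulShortComplex_shortExact (M := ModuleCat.of R M) hreg
    have hquot : ExtDepthGE m d (QuotSMulTop r M) :=
      right_of_shortExact hS h (h.mono d.le_succ)
    obtain ⟨rs, hlen, hmem, hrs⟩ := ih hquot
    exact ⟨r :: rs, by simp [hlen], by simpa using ⟨hr, hmem⟩, hrs.cons hreg⟩

/-- The depth of `R / J` is controlled by those of `R / (J : f)` and `R / (J + (f))`. -/
theorem of_colon {J C : Ideal R} {f : R} (hC : ∀ g, g ∈ C ↔ f * g ∈ J)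
    (h₁ : ExtDepthGE m d (R ⧸ C)) (h₂ : ExtDepthGE m d (R ⧸ (J ⊔ Ideal.span {f}))) :
    ExtDepthGE m d (R ⧸ J) :=
  middle_of_shortExact (Ideal.colonComplex_shortExact hC) h₁ h₂

/-- If `f ∈ m` is regular modulo `J`, passing from `R / (J + (f))` to `R / J` raises the depth
by one. -/
theorem succ_of_quotient {J : Ideal R} {f : R} (hf : f ∈ m) (hreg : ∀ g, f * g ∈ J → g ∈ J)
    (h : ExtDepthGE m d (R ⧸ (J ⊔ Ideal.span {f}))) : ExtDepthGE m (d + 1) (R ⧸ J) := by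
  have hC : ∀ g, g ∈ J ↔ f * g ∈ J := fun g => ⟨J.mul_mem_left f, hreg g⟩
  have hS := Ideal.colonComplex_shortExact hC
  intro i hi
  refine subsingleton_of_forall_eq 0 fun x => ?_
  have hid : f • 𝟙 (ModuleCat.of R (R ⧸ m)) = 0 := by
    ext
    change f • (1 : R ⧸ m) = 0
    rw [Algebra.smul_def, mul_one]
    exact Ideal.Quotient.eq_zero_iff_mem.mpr hf
  have hx : f • x = 0 := by
    rw [← Abelian.Ext.mk₀_id_comp x, ← Abelian.Ext.smul_comp, ← Abelian.Ext.mk₀_smul, hid,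
      Abelian.Ext.mk₀_zero, Abelian.Ext.zero_comp]
  have hfid : (Ideal.colonComplex hC).f = f • 𝟙 (ModuleCat.of R (R ⧸ J)) := by
    ext y
    obtain ⟨g, rfl⟩ := Submodule.Quotient.mk_surjective J y
    rfl
  have hx' : x.comp (Abelian.Ext.mk₀ (Ideal.colonComplex hC).f) (add_zero i) = 0 := by
    rw [hfid]
    exact (Abelian.Ext.smul_eq_comp_mk₀ x f).symm.trans hx
  cases i with
  | zero =>
    have hsub : Subsingleton ((R ⧸ m) →ₗ[R] (R ⧸ J)) :=
      IsSMulRegular.linearMap_subsingleton_of_mem_annihilator (r := f)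
        (fun a b hab => Ideal.colonMap_injective hC (by
          obtain ⟨a, rfl⟩ := Submodule.Quotient.mk_surjective J a
          obtain ⟨b, rfl⟩ := Submodule.Quotient.mk_surjective J b
          exact hab)) (by rwa [Ideal.annihilator_quotient])
    exact ((Abelian.Ext.homEquiv₀ (X := ModuleCat.of R (R ⧸ m))
      (Y := ModuleCat.of R (R ⧸ J))).trans ModuleCat.homEquiv).subsingleton.elim _ _
  | succ i =>
    obtain ⟨y, hy⟩ := Abelian.Ext.covariant_sequence_exact₁ _ hS x hx' rfl
    have hy0 : y = 0 := (h i (by lia)).elim _ _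
    rw [← hy, hy0]
    exact Abelian.Ext.zero_comp ..

end ExtDepthGE

/-- The lengths of regular sequences are bounded by the Krull dimension. -/
theorem RingTheory.Sequence.IsRegular.length_le_ringKrullDim [IsNoetherianRing R] {M : Type u}
    [AddCommGroup M] [Module R M] [Module.Finite R M] {rs : List R} (h : IsRegular M rs) :
    (rs.length : WithBot ℕ∞) ≤ ringKrullDim R := by
  refine le_trans ?_ (Module.supportDim_le_ringKrullDim R M)
  induction rs generalizing M with
  | nil =>
    have := h.nontrivial
    have := Module.supportDim_ne_bot_of_nontrivial R M
    obtain ⟨a, ha⟩ := WithBot.ne_bot_iff_exists.mp this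
    rw [← ha]
    exact WithBot.coe_le_coe.mpr (zero_le (a := a))
  | cons r rs ih =>
    rw [isRegular_cons_iff] at h
    refine le_trans ?_ (Module.supportDim_quotSMulTop_succ_le_of_notMem_minimalPrimes
      fun _ => h.1.notMem_of_mem_minimalPrimes)
    push_cast [List.length_cons]
    gcongr
    exact ih h.2

end ExtDepth

section MonomialIdeals

variable {σ : Type*} {K : Type*} [Field K] {U V W : Set (σ →₀ ℕ)} {d : ℕ}

variable (K) in
/-- The ideal spanned by the monomials with exponents in `U`. -/
noncomputable def monIdeal (U : Set (σ →₀ ℕ)) : Ideal (MvPolynomial σ K) :=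
  Ideal.span ((fun s => monomial s 1) '' U)

theorem mem_monIdeal (hU : IsUpperSet U) {f : MvPolynomial σ K} :
    f ∈ monIdeal K U ↔ ∀ s ∈ f.support, s ∈ U := by
  rw [monIdeal, mem_ideal_span_monomial_image]
  exact forall₂_congr fun s _ => ⟨fun ⟨t, ht, hts⟩ => hU hts ht, fun hs => ⟨s, hs, le_rfl⟩⟩

theorem monomial_mul_mem_monIdeal (hU : IsUpperSet U) {s : σ →₀ ℕ}
    (hV : ∀ t, t ∈ V ↔ s + t ∈ U) (g : MvPolynomial σ K) :
    g ∈ monIdeal K V ↔ monomial s 1 * g ∈ monIdeal K U := by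
  have hVup : IsUpperSet V := fun a b hab ha =>
    (hV b).mpr (hU (add_le_add_right hab s) ((hV a).mp ha))
  rw [mem_monIdeal hU, mem_monIdeal hVup]
  constructor
  · intro h t ht
    rw [mem_support_iff, coeff_monomial_mul'] at ht
    split_ifs at ht with hst
    · rw [← add_tsub_cancel_of_le hst]
      exact (hV _).mp (h _ (by simpa using ht))
    · exact absurd rfl ht
  · intro h t ht
    refine (hV t).mpr (h _ ?_)
    rw [mem_support_iff, coeff_monomial_mul, one_mul]
    exact mem_support_iff.mp ht

theorem monIdeal_sup_span_monomial (hU : IsUpperSet U) {s : σ →₀ ℕ}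
    (hW : ∀ t, t ∈ W ↔ t ∈ U ∨ s ≤ t) :
    monIdeal K U ⊔ Ideal.span {monomial s 1} = monIdeal K W := by
  have hWup : IsUpperSet W := fun a b hab ha =>
    (hW b).mpr (((hW a).mp ha).imp (hU hab) fun h => h.trans hab)
  ext f
  rw [mem_monIdeal hWup, monIdeal, ← Ideal.span_union,
    ← Set.image_singleton (f := fun s : σ →₀ ℕ => monomial s (1 : K)), ← Set.image_union,
    mem_ideal_span_monomial_image]
  refine forall₂_congr fun t _ => ?_
  rw [hW]
  constructor
  · rintro ⟨r, hr | rfl, hrt⟩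
    · exact Or.inl (hU hrt hr)
    · exact Or.inr hrt
  · rintro (h | h)
    · exact ⟨t, Or.inl h, le_rfl⟩
    · exact ⟨s, Or.inr rfl, h⟩

variable (K) in
/-- The lower bound `d` for the depth of the quotient by the monomial ideal with exponents `U`. -/
def MonDepthGE (d : ℕ) (U : Set (σ →₀ ℕ)) : Prop :=
  ExtDepthGE (maxIdeal σ K) d (MvPolynomial σ K ⧸ monIdeal K U)

theorem MonDepthGE.of_colon (hU : IsUpperSet U) (s : σ →₀ ℕ) (hV : ∀ t, t ∈ V ↔ s + t ∈ U)
    (hW : ∀ t, t ∈ W ↔ t ∈ U ∨ s ≤ t) (h₁ : MonDepthGE K d V) (h₂ : MonDepthGE K d W) :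
    MonDepthGE K d U := by
  unfold MonDepthGE at h₂
  rw [← monIdeal_sup_span_monomial hU hW] at h₂
  exact ExtDepthGE.of_colon (monomial_mul_mem_monIdeal hU hV) h₁ h₂

theorem MonDepthGE.succ (hU : IsUpperSet U) (x : σ)
    (hreg : ∀ t, Finsupp.single x 1 + t ∈ U → t ∈ U)
    (hW : ∀ t, t ∈ W ↔ t ∈ U ∨ Finsupp.single x 1 ≤ t) (h : MonDepthGE K d W) :
    MonDepthGE K (d + 1) U := by
  unfold MonDepthGE at h
  rw [← monIdeal_sup_span_monomial hU hW] at h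
  refine ExtDepthGE.succ_of_quotient (Ideal.subset_span ⟨x, rfl⟩) (fun g => ?_) h
  exact (monomial_mul_mem_monIdeal hU
    (fun t => ⟨fun ht => hU le_add_self ht, hreg t⟩) g).mpr

theorem MonDepthGE.of_eq_univ (hU : U = Set.univ) : MonDepthGE K d U := by
  have htop : monIdeal K U = ⊤ := by
    ext f
    rw [mem_monIdeal (hU ▸ isUpperSet_univ), hU]
    simp
  unfold MonDepthGE
  rw [htop]
  exact ExtDepthGE.quotient_top

end MonomialIdeals

section EdgePowers

open Finsupp (single)

variable {σ : Type*}

theorem Finsupp.single_one_add_eq_iff {a b : σ} {s t : σ →₀ ℕ} :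
    single a 1 + s = single b 1 + t ↔
      a = b ∧ s = t ∨ a ≠ b ∧ ∃ r, s = single b 1 + r ∧ t = single a 1 + r := by
  classical
  constructor
  · intro h
    by_cases hab : a = b
    · subst hab
      exact Or.inl ⟨rfl, add_left_cancel h⟩
    · refine Or.inr ⟨hab, t - single a 1, ?_⟩
      have hle : single a 1 ≤ t := by
        have := DFunLike.congr_fun h a
        simp [Ne.symm hab] at this
        simp
        lia
      have ht : t = single a 1 + (t - single a 1) := (add_tsub_cancel_of_le hle).symm
      refine ⟨?_, ht⟩
      rw [ht, add_left_comm] at h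
      exact add_left_cancel h
  · rintro (⟨rfl, rfl⟩ | ⟨-, r, rfl, rfl⟩)
    · rfl
    · exact add_left_comm _ _ _

/-- The exponents of the monomials lying in the `k`-th power of the edge ideal of `H`. -/
def edgePow (H : SimpleGraph σ) : ℕ → Set (σ →₀ ℕ)
  | 0 => Set.univ
  | k + 1 => {s | ∃ a b, H.Adj a b ∧ ∃ t ∈ edgePow H k, s = single a 1 + (single b 1 + t)}

variable {H H' : SimpleGraph σ} {k : ℕ} {s t : σ →₀ ℕ} {y z u v : σ}

theorem isUpperSet_edgePow (H : SimpleGraph σ) (k : ℕ) : IsUpperSet (edgePow H k) := by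
  induction k with
  | zero => exact isUpperSet_univ
  | succ k ih =>
    rintro s t hst ⟨a, b, hab, r, hr, rfl⟩
    obtain ⟨c, rfl⟩ := le_iff_exists_add.mp hst
    exact ⟨a, b, hab, r + c, ih le_self_add hr, by simp only [add_assoc]⟩

theorem edgePow_mono (h : H ≤ H') (hs : s ∈ edgePow H k) : s ∈ edgePow H' k := by
  induction k generalizing s with
  | zero => trivial
  | succ k ih =>
    obtain ⟨a, b, hab, t, ht, rfl⟩ := hs
    exact ⟨a, b, h hab, t, ih ht, rfl⟩

theorem edgePow_deleteIncidenceSet (hs : s ∈ edgePow H k) (hv : s v = 0) :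
    s ∈ edgePow (H.deleteIncidenceSet v) k := by
  classical
  induction k generalizing s with
  | zero => trivial
  | succ k ih =>
    obtain ⟨a, b, hab, t, ht, rfl⟩ := hs
    simp only [Finsupp.add_apply, Finsupp.single_apply] at hv
    refine ⟨a, b, H.deleteIncidenceSet_adj.mpr ⟨hab, ?_, ?_⟩, t, ih ht (by lia), rfl⟩ <;>
      · rintro rfl
        simp at hv

/-- A leaf can be traded for any other neighbour of its unique neighbour. -/
theorem edgePow_replace_leaf (hy : ∀ w, H.Adj y w → w = z) (hu : H.Adj z u)
    (hs : single y 1 + s ∈ edgePow H k) : single u 1 + s ∈ edgePow H k := by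
  induction k generalizing s with
  | zero => trivial
  | succ k ih =>
    obtain ⟨a, b, hab, t, ht, h⟩ := hs
    obtain ⟨rfl, rfl⟩ | ⟨-, r, rfl, h'⟩ := Finsupp.single_one_add_eq_iff.mp h
    · rw [hy b hab]
      exact ⟨u, z, hu.symm, _, ht, rfl⟩
    obtain ⟨rfl, rfl⟩ | ⟨-, r, rfl, rfl⟩ := Finsupp.single_one_add_eq_iff.mp h'.symm
    · rw [hy a hab.symm]
      exact ⟨u, z, hu.symm, _, ht, rfl⟩
    · exact ⟨a, b, hab, _, ih ht, by abel⟩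

theorem edgePow_cancel_leaf (hy : ∀ w, H.Adj y w → w = z) (hyz : H.Adj y z)
    (hs : single y 1 + (single z 1 + s) ∈ edgePow H (k + 1)) : s ∈ edgePow H k := by
  induction k generalizing s with
  | zero => trivial
  | succ k ih =>
    obtain ⟨a, b, hab, t, ht, h⟩ := hs
    wlog haz : b ≠ z generalizing a b
    · have hbz : b = z := not_not.mp haz
      by_cases haz' : a = z
      · exact absurd (haz'.trans hbz.symm) hab.ne
      · exact this b a hab.symm (by rw [h]; abel) haz'
    obtain ⟨rfl, h⟩ | ⟨hya, r, h₁, h₂⟩ := Finsupp.single_one_add_eq_iff.mp h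
    · exact absurd (hy b hab) haz
    obtain ⟨rfl, rfl⟩ | ⟨hby, r', rfl, rfl⟩ := Finsupp.single_one_add_eq_iff.mp h₂
    · rw [hy a hab.symm] at h₁
      rwa [add_left_cancel h₁]
    obtain ⟨rfl, rfl⟩ | ⟨hza, r'', rfl, h₃⟩ := Finsupp.single_one_add_eq_iff.mp h₁
    · exact edgePow_replace_leaf hy hab ht
    · obtain ⟨rfl, rfl⟩ | ⟨-, q, rfl, rfl⟩ := Finsupp.single_one_add_eq_iff.mp h₃
      · exact absurd rfl haz
      · exact ⟨a, b, hab, q, ih ht, rfl⟩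

theorem edgePow_cancel_isolated (hz : ∀ w, ¬ H.Adj z w) (hs : single z 1 + s ∈ edgePow H k) :
    s ∈ edgePow H k := by
  induction k generalizing s with
  | zero => trivial
  | succ k ih =>
    obtain ⟨a, b, hab, t, ht, h⟩ := hs
    obtain ⟨rfl, rfl⟩ | ⟨-, r, rfl, h'⟩ := Finsupp.single_one_add_eq_iff.mp h
    · exact absurd hab (hz b)
    obtain ⟨rfl, rfl⟩ | ⟨-, r, rfl, rfl⟩ := Finsupp.single_one_add_eq_iff.mp h'.symm
    · exact absurd hab.symm (hz a)
    · exact ⟨a, b, hab, _, ih ht, rfl⟩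

/-- The exponents of the monomials lying in the sum of the `k`-th power of the edge ideal of `H`
and the ideal generated by the variables in `Y`. -/
def edgePowSup (H : SimpleGraph σ) (k : ℕ) (Y : Set σ) : Set (σ →₀ ℕ) :=
  {s | s ∈ edgePow H k ∨ ∃ y ∈ Y, s y ≠ 0}

variable {Y : Set σ}

theorem isUpperSet_edgePowSup (H : SimpleGraph σ) (k : ℕ) (Y : Set σ) :
    IsUpperSet (edgePowSup H k Y) := by
  rintro s t hst (hs | ⟨y, hy, hs⟩)
  · exact Or.inl (isUpperSet_edgePow H k hst hs)
  · exact Or.inr ⟨y, hy, ((Nat.pos_of_ne_zero hs).trans_le (hst y)).ne'⟩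

theorem mem_edgePowSup_insert :
    s ∈ edgePowSup (H.deleteIncidenceSet v) k (insert v Y) ↔ s ∈ edgePowSup H k Y ∨ s v ≠ 0 := by
  simp only [edgePowSup, Set.mem_ofPred_eq, Set.exists_mem_insert]
  have h₁ : s ∈ edgePow (H.deleteIncidenceSet v) k → s ∈ edgePow H k :=
    edgePow_mono (H.deleteIncidenceSet_le v)
  have h₂ : s ∈ edgePow H k → s v = 0 → s ∈ edgePow (H.deleteIncidenceSet v) k :=
    edgePow_deleteIncidenceSet
  grind

theorem single_add_mem_edgePowSup_iff (hz : ∀ w, ¬ H.Adj z w) (hzY : z ∉ Y) :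
    single z 1 + s ∈ edgePowSup H k Y ↔ s ∈ edgePowSup H k Y := by
  refine ⟨?_, isUpperSet_edgePowSup H k Y le_add_self⟩
  rintro (h | ⟨y, hy, h⟩)
  · exact Or.inl (edgePow_cancel_isolated hz h)
  · refine Or.inr ⟨y, hy, ?_⟩
    rwa [Finsupp.add_apply, Finsupp.single_eq_of_ne (by rintro rfl; exact hzY hy), zero_add] at h

theorem single_add_single_add_mem_edgePowSup_iff (hy : ∀ w, H.Adj y w → w = z)
    (hyz : H.Adj y z) (hyY : y ∉ Y) (hzY : z ∉ Y) :
    single y 1 + (single z 1 + s) ∈ edgePowSup H (k + 1) Y ↔ s ∈ edgePowSup H k Y := by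
  constructor
  · rintro (h | ⟨v, hv, h⟩)
    · exact Or.inl (edgePow_cancel_leaf hy hyz h)
    · refine Or.inr ⟨v, hv, ?_⟩
      rwa [Finsupp.add_apply, Finsupp.add_apply,
        Finsupp.single_eq_of_ne (by rintro rfl; exact hyY hv),
        Finsupp.single_eq_of_ne (by rintro rfl; exact hzY hv), zero_add, zero_add] at h
  · rintro (h | ⟨v, hv, h⟩)
    · exact Or.inl ⟨y, z, hyz, s, h, rfl⟩
    · exact Or.inr ⟨v, hv, by simp [h]⟩

end EdgePowers

section Forests

variable {V : Type*}

/-- `H` is a rooted forest with height function `δ`: adjacent vertices have different heights, and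
every vertex has at most one neighbour, its parent, of smaller height. -/
structure SimpleGraph.IsRootedForest (H : SimpleGraph V) (δ : V → ℕ) : Prop where
  height_ne : ∀ {a b}, H.Adj a b → δ a ≠ δ b
  parent_unique : ∀ {a b c}, H.Adj a b → H.Adj a c → δ b < δ a → δ c < δ a → b = c

namespace SimpleGraph

variable {H H' : SimpleGraph V} {δ : V → ℕ}

theorem IsRootedForest.mono (h : H'.IsRootedForest δ) (hle : H ≤ H') : H.IsRootedForest δ where
  height_ne hab := h.height_ne (hle hab)
  parent_unique hab hac := h.parent_unique (hle hab) (hle hac)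

/-- A rooted forest with an edge has a leaf whose neighbour has at most one non-leaf neighbour. -/
theorem IsRootedForest.exists_leaf [Finite V] (h : H.IsRootedForest δ) {p q : V}
    (hpq : H.Adj p q) :
    ∃ y z u, H.Adj y z ∧ (∀ w, H.Adj y w → w = z) ∧
      ∀ w, H.Adj z w → w ≠ u → ∀ t, H.Adj w t → t = z := by
  let S : Set V := {z | ∃ y, H.Adj z y ∧ δ z < δ y}
  have hS : S.Nonempty := by
    rcases lt_or_gt_of_ne (h.height_ne hpq) with hlt | hlt
    · exact ⟨p, q, hpq, hlt⟩
    · exact ⟨q, p, hpq.symm, hlt⟩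
  obtain ⟨z, ⟨y, hzy, hlt⟩, hmax⟩ := S.toFinite.exists_maximalFor δ S hS
  have hleaf : ∀ w, H.Adj z w → δ z < δ w → ∀ t, H.Adj w t → t = z := by
    intro w hzw hw t hwt
    rcases lt_or_gt_of_ne (h.height_ne hwt) with hlt' | hlt'
    · exact absurd (hmax ⟨t, hwt, hlt'⟩ hw.le) hw.not_ge
    · exact h.parent_unique hwt hzw.symm hlt' hw
  by_cases hu : ∃ u, H.Adj z u ∧ δ u < δ z
  · obtain ⟨u, hzu, hu⟩ := hu
    refine ⟨y, z, u, hzy.symm, hleaf y hzy hlt, fun w hzw hwu => hleaf w hzw ?_⟩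
    refine (lt_or_gt_of_ne (h.height_ne hzw)).resolve_right fun hwz => hwu ?_
    exact h.parent_unique hzw hzu hwz hu
  · refine ⟨y, z, z, hzy.symm, hleaf y hzy hlt, fun w hzw _ => hleaf w hzw ?_⟩
    exact (lt_or_gt_of_ne (h.height_ne hzw)).resolve_right fun hwz => hu ⟨w, hzw, hwz⟩

theorem IsAcyclic.exists_isRootedForest (hH : H.IsAcyclic) : ∃ δ, H.IsRootedForest δ := by
  let root : V → V := fun v => (H.connectedComponentMk v).out
  have hroot : ∀ v, H.Reachable (root v) v := fun v =>
    ConnectedComponent.exact (Quot.out_eq (H.connectedComponentMk v))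
  have hroot_eq : ∀ {a b}, H.Adj a b → root a = root b := fun hab =>
    congrArg Quot.out (ConnectedComponent.sound hab.reachable)
  have hparent : ∀ {r a b : V}, H.Adj a b → H.Reachable r a → H.dist r b < H.dist r a →
      ∀ p : H.Walk r a, p.IsPath → b = p.penultimate := by
    intro r a b hab hra hlt p hp
    obtain ⟨q, hq, hqlen⟩ := (hra.trans hab.reachable).exists_path_of_dist
    refine hH.eq_penultimate_of_adj_end hp hab ?_
    refine hH.mem_support_of_ne_mem_support_of_adj_of_isPath hp hq hab fun ha => ?_
    classical
    have h₁ := dist_le (q.takeUntil a ha)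
    have h₂ := q.length_takeUntil_le_length ha
    lia
  refine ⟨fun v => H.dist (root v) v, fun {a b} hab => ?_, fun {a b c} hab hac hb hc => ?_⟩
  · rw [← hroot_eq hab]
    exact hH.dist_ne_of_adj hab (hroot a)
  · rw [← hroot_eq hab] at hb
    rw [← hroot_eq hac] at hc
    obtain ⟨p, hp, -⟩ := (hroot a).exists_path_of_dist
    exact (hparent hab (hroot a) hb p hp).trans (hparent hac (hroot a) hc p hp).symm

/-- The closed neighbourhoods of the members of `A` are pairwise disjoint. -/
def IsNeighborPacking (H : SimpleGraph V) (A : Finset V) : Prop :=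
  ∀ a ∈ A, ∀ b ∈ A, ∀ v, (v = a ∨ H.Adj v a) → (v = b ∨ H.Adj v b) → a = b

theorem IsNeighborPacking.anti {A B : Finset V} (hA : H'.IsNeighborPacking A) (hle : H ≤ H')
    (hBA : B ⊆ A) : H.IsNeighborPacking B :=
  fun a ha b hb v hva hvb =>
    hA a (hBA ha) b (hBA hb) v (hva.imp_right (hle ·)) (hvb.imp_right (hle ·))

theorem IsNeighborPacking.insert_isolated [DecidableEq V] {A : Finset V} {z : V}
    (hA : H.IsNeighborPacking A) (hz : ∀ w, ¬ H.Adj z w) :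
    H.IsNeighborPacking (insert z A) := by
  have hz' : ∀ w, ¬ H.Adj w z := fun w h => hz w h.symm
  intro a ha b hb v hva hvb
  rw [Finset.mem_insert] at ha hb
  rcases ha with rfl | ha <;> rcases hb with rfl | hb
  · rfl
  · rcases hva with rfl | h
    · rcases hvb with h | h
      · exact h
      · exact absurd h (hz _)
    · exact absurd h (hz' _)
  · rcases hvb with rfl | h
    · rcases hva with h | h
      · exact h.symm
      · exact absurd h (hz _)
    · exact absurd h (hz' _)
  · exact hA a ha b hb v hva hvb

theorem deleteIncidenceSet_lt {v w : V} (h : H.Adj v w) : H.deleteIncidenceSet v < H := by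
  refine lt_of_le_of_ne (H.deleteIncidenceSet_le v) fun heq => ?_
  rw [← heq, deleteIncidenceSet_adj] at h
  exact h.2.1 rfl

end SimpleGraph

end Forests

section ForestDepth

open Finsupp (single)

variable {σ : Type*} (K : Type*) [Field K]

theorem monDepthGE_of_no_edges {H : SimpleGraph σ} (hH : ∀ a b, ¬ H.Adj a b) {k d : ℕ}
    {Y : Set σ} {A : Finset σ} (hAY : ∀ a ∈ A, a ∉ Y) (hd : d ≤ A.card) :
    MonDepthGE K d (edgePowSup H k Y) := by
  classical
  induction d generalizing Y A with
  | zero => exact ExtDepthGE.zero _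
  | succ d ih =>
    obtain ⟨x, hx⟩ := Finset.card_pos.mp (d.succ_pos.trans_le hd)
    have hdel : H.deleteIncidenceSet x = H := by
      ext a b
      exact iff_of_false (fun h => hH a b (H.deleteIncidenceSet_le x h)) (hH a b)
    refine MonDepthGE.succ (isUpperSet_edgePowSup H k Y) x
      (fun t => (single_add_mem_edgePowSup_iff (hH x) (hAY x hx)).mp)
      (W := edgePowSup H k (insert x Y)) (fun t => ?_)
      (ih (A := A.erase x) (fun a ha => ?_) ?_)
    · conv_lhs => rw [← hdel]
      rw [mem_edgePowSup_insert, Finsupp.single_le_iff, Nat.one_le_iff_ne_zero]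
    · rw [Finset.mem_erase] at ha
      rintro (h | h)
      · exact ha.1 h
      · exact hAY a ha.2 h
    · rw [Finset.card_erase_of_mem hx]
      lia

/-- Depth of `(I(H)^(k+1) + (Y)) : z` for a vertex `z` with at most one non-leaf neighbour. -/
theorem monDepthGE_colon [Finite σ] {δ : σ → ℕ} {k d : ℕ} {z u₀ : σ} {A : Finset σ} (hzA : z ∉ A)
    (hd : d + (k + 1) ≤ A.card + 2) (H : SimpleGraph σ) (Y : Set σ)
    (hH : H.IsRootedForest δ) (hY : ∀ y ∈ Y, ∀ w, ¬ H.Adj y w) (hzY : z ∉ Y)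
    (hAY : ∀ a ∈ A, a ∉ Y) (hA : H.IsNeighborPacking A) (hAz : ∀ a ∈ A, ¬ H.Adj a z)
    (hz : ∀ w, H.Adj z w → w ≠ u₀ → ∀ t, H.Adj w t → t = z)
    (ihk : ∀ (Y' : Set σ) (H' : SimpleGraph σ) (B : Finset σ), H'.IsRootedForest δ →
      (∀ y ∈ Y', ∀ w, ¬ H'.Adj y w) → (∀ a ∈ B, a ∉ Y') → H'.IsNeighborPacking B →
      d + k ≤ B.card + 1 → MonDepthGE K d (edgePowSup H' k Y'))
    (ihH : ∀ (Y' : Set σ) (H' : SimpleGraph σ) (B : Finset σ), H' ≤ H →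
      H'.IsRootedForest δ → (∀ y ∈ Y', ∀ w, ¬ H'.Adj y w) → (∀ a ∈ B, a ∉ Y') →
      H'.IsNeighborPacking B → d + (k + 1) ≤ B.card + 1 →
      MonDepthGE K d (edgePowSup H' (k + 1) Y')) :
    MonDepthGE K d {s | single z 1 + s ∈ edgePowSup H (k + 1) Y} := by
  classical
  induction H using WellFoundedLT.induction generalizing Y with
  | ind H ih =>
  by_cases hiso : ∀ w, ¬ H.Adj z w
  · have heq : {s | single z 1 + s ∈ edgePowSup H (k + 1) Y} = edgePowSup H (k + 1) Y :=
      Set.ext fun s => single_add_mem_edgePowSup_iff hiso hzY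
    rw [heq]
    refine ihH Y H (insert z A) le_rfl hH hY ?_ (hA.insert_isolated hiso) ?_
    · intro a ha
      rcases Finset.mem_insert.mp ha with rfl | ha
      · exact hzY
      · exact hAY a ha
    · rw [Finset.card_insert_of_notMem hzA]
      lia
  · obtain ⟨u, hzu, hleaf⟩ : ∃ u, H.Adj z u ∧
        ((∀ w, H.Adj u w → w = z) ∨ ∀ w, H.Adj z w → w = u) := by
      push Not at hiso
      obtain ⟨u, hzu⟩ := hiso
      by_cases h : ∃ w, H.Adj z w ∧ w ≠ u₀
      · obtain ⟨w, hzw, hw⟩ := h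
        exact ⟨w, hzw, Or.inl (hz w hzw hw)⟩
      · push Not at h
        exact ⟨u, hzu, Or.inr fun w hzw => (h w hzw).trans (h u hzu).symm⟩
    have huY : u ∉ Y := fun h => hY u h z hzu.symm
    have hup : IsUpperSet {s | single z 1 + s ∈ edgePowSup H (k + 1) Y} := fun s t hst hs =>
      isUpperSet_edgePowSup H (k + 1) Y (add_le_add_right hst _) hs
    have hle : H.deleteIncidenceSet u ≤ H := H.deleteIncidenceSet_le u
    refine MonDepthGE.of_colon hup (single u 1) (V := edgePowSup H k Y)
      (W := {s | single z 1 + s ∈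
        edgePowSup (H.deleteIncidenceSet u) (k + 1) (insert u Y)}) ?_ ?_ ?_ ?_
    · intro t
      rw [Set.mem_ofPred_eq]
      rcases hleaf with hleaf | hleaf
      · rw [add_left_comm, single_add_single_add_mem_edgePowSup_iff hleaf hzu.symm huY hzY]
      · rw [single_add_single_add_mem_edgePowSup_iff hleaf hzu hzY huY]
    · intro t
      rw [Set.mem_ofPred_eq, Set.mem_ofPred_eq, mem_edgePowSup_insert, Finsupp.single_le_iff,
        Nat.one_le_iff_ne_zero, Finsupp.add_apply, Finsupp.single_eq_of_ne hzu.ne', zero_add]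
    · exact ihk Y H A hH hY hAY hA (by lia)
    · refine ih _ (SimpleGraph.deleteIncidenceSet_lt hzu.symm) (insert u Y) (hH.mono hle) ?_ ?_ ?_
        (hA.anti hle subset_rfl) (fun a ha h => hAz a ha (hle h))
        (fun w hzw hw t hwt => hz w (hle hzw) hw t (hle hwt))
        fun Y' H' B hH' => ihH Y' H' B (hH'.trans hle)
      · rintro y (rfl | hy) w hyw
        · exact (SimpleGraph.deleteIncidenceSet_adj.mp hyw).2.1 rfl
        · exact hY y hy w (hle hyw)
      · rintro (h | h)
        · exact hzu.ne h
        · exact hzY h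
      · rintro a ha (rfl | h)
        · exact hAz _ ha hzu.symm
        · exact hAY a ha h

theorem monDepthGE_edgePowSup [Finite σ] {δ : σ → ℕ} {d : ℕ} (k : ℕ) (Y : Set σ) (H : SimpleGraph σ)
    (A : Finset σ) (hH : H.IsRootedForest δ) (hY : ∀ y ∈ Y, ∀ w, ¬ H.Adj y w)
    (hAY : ∀ a ∈ A, a ∉ Y) (hA : H.IsNeighborPacking A) (hd : d + k ≤ A.card + 1) :
    MonDepthGE K d (edgePowSup H k Y) := by
  classical
  induction k generalizing Y H A with
  | zero => exact MonDepthGE.of_eq_univ (Set.eq_univ_of_forall fun s => Or.inl trivial)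
  | succ k ihk =>
  induction H using WellFoundedLT.induction generalizing Y A with
  | ind H ihH =>
  by_cases hedge : ∀ a b, ¬ H.Adj a b
  · exact monDepthGE_of_no_edges K hedge hAY (by lia)
  push Not at hedge
  obtain ⟨p, q, hpq⟩ := hedge
  obtain ⟨y, z, u₀, hyz, hy, hz⟩ := hH.exists_leaf hpq
  have hyY : y ∉ Y := fun h => hY y h z hyz
  have hzY : z ∉ Y := fun h => hY z h y hyz.symm
  have hdely : H.deleteIncidenceSet y ≤ H := H.deleteIncidenceSet_le y
  have hdelz : H.deleteIncidenceSet z ≤ H := H.deleteIncidenceSet_le z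
  have hisolated : ∀ v, ∀ x ∈ insert v Y, ∀ w, ¬ (H.deleteIncidenceSet v).Adj x w := by
    rintro v x (rfl | hx) w hxw
    · exact (SimpleGraph.deleteIncidenceSet_adj.mp hxw).2.1 rfl
    · exact hY x hx w (H.deleteIncidenceSet_le v hxw)
  have hle_iff : ∀ s : σ →₀ ℕ, single y 1 + single z 1 ≤ s ↔ s y ≠ 0 ∧ s z ≠ 0 := by
    intro s
    have hne := hyz.ne
    constructor
    · intro h
      have h₁ := h y
      have h₂ := h z
      simp [hne, hne.symm] at h₁ h₂
      lia
    · rintro ⟨h₁, h₂⟩ v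
      by_cases hvy : v = y
      · subst hvy
        simp [hne]
        lia
      · by_cases hvz : v = z
        · subst hvz
          simp [hne.symm]
          lia
        · simp [hvy, hvz]
  let J : Set (σ →₀ ℕ) := {s | s ∈ edgePowSup H (k + 1) Y ∨ single y 1 + single z 1 ≤ s}
  have hJ : IsUpperSet J := fun s t hst hs =>
    hs.imp (isUpperSet_edgePowSup H (k + 1) Y hst) fun h => h.trans hst
  refine MonDepthGE.of_colon (isUpperSet_edgePowSup H (k + 1) Y) (single y 1 + single z 1)
    (V := edgePowSup H k Y) (W := J) (fun t => ?_) (fun t => Iff.rfl)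
    (ihk Y H A hH hY hAY hA (by lia)) ?_
  · rw [add_assoc, single_add_single_add_mem_edgePowSup_iff hy hyz hyY hzY]
  refine MonDepthGE.of_colon hJ (single z 1)
    (V := {s | single z 1 + s ∈
      edgePowSup (H.deleteIncidenceSet y) (k + 1) (insert y Y)})
    (W := edgePowSup (H.deleteIncidenceSet z) (k + 1) (insert z Y)) ?_ ?_ ?_ ?_
  · intro t
    rw [Set.mem_ofPred_eq, Set.mem_ofPred_eq, mem_edgePowSup_insert, hle_iff]
    simp
  · intro t
    rw [Set.mem_ofPred_eq, mem_edgePowSup_insert, Finsupp.single_le_iff,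
      Nat.one_le_iff_ne_zero, hle_iff]
    tauto
  · let B : Finset σ := A.filter fun a => a ≠ z ∧ ¬ H.Adj a z
    have hBA : B ⊆ A := Finset.filter_subset _ _
    have hB : ∀ a ∈ B, a ≠ z ∧ ¬ H.Adj a z := fun a ha => (Finset.mem_filter.mp ha).2
    have hcard : A.card ≤ B.card + 1 := by
      rw [← Finset.card_filter_add_card_filter_not (s := A) (fun a => a ≠ z ∧ ¬ H.Adj a z)]
      refine Nat.add_le_add_left (Finset.card_le_one.mpr fun a ha b hb => ?_) _
      have hmem : ∀ c ∈ A.filter (fun a => ¬ (a ≠ z ∧ ¬ H.Adj a z)),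
          c ∈ A ∧ (z = c ∨ H.Adj z c) := by
        intro c hc
        obtain ⟨hcA, hc⟩ := Finset.mem_filter.mp hc
        refine ⟨hcA, ?_⟩
        by_cases hcz : c = z
        · exact Or.inl hcz.symm
        · exact Or.inr (not_not.mp fun h => hc ⟨hcz, fun h' => h h'.symm⟩)
      exact hA a (hmem a ha).1 b (hmem b hb).1 z (hmem a ha).2 (hmem b hb).2
    refine monDepthGE_colon K (fun h => (hB z h).1 rfl) (by lia) _ _ (hH.mono hdely)
      (hisolated y) ?_ ?_ (hA.anti hdely hBA) (fun a ha h => (hB a ha).2 (hdely h))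
      (fun w hzw hw t hwt => hz w (hdely hzw) hw t (hdely hwt))
      (fun Y' H' B => ihk Y' H' B)
      fun Y' H' B hH' hF hY' hBY' hB' hd' => ihH H'
        (hH'.trans_lt (SimpleGraph.deleteIncidenceSet_lt hyz)) Y' B hF hY' hBY' hB' hd'
    · rintro (h | h)
      · exact hyz.ne h.symm
      · exact hzY h
    · rintro a ha (rfl | h)
      · exact (hB _ ha).2 hyz
      · exact hAY a (hBA ha) h
  · by_cases hzA : z ∈ A
    · have hy_iso : ∀ w, ¬ (H.deleteIncidenceSet z).Adj y w := fun w h =>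
        (SimpleGraph.deleteIncidenceSet_adj.mp h).2.2 (hy w (hdelz h))
      have hyA : y ∉ A := fun h => hyz.ne (hA y h z hzA y (Or.inl rfl) (Or.inr hyz))
      refine ihH _ (SimpleGraph.deleteIncidenceSet_lt hyz.symm) _ (insert y (A.erase z))
        (hH.mono hdelz) (hisolated z) ?_
        ((hA.anti hdelz (Finset.erase_subset z A)).insert_isolated hy_iso) ?_
      · intro a ha
        rw [Finset.mem_insert, Finset.mem_erase] at ha
        rintro (h | h)
        · rcases ha with rfl | ha
          · exact hyz.ne h
          · exact ha.1 h
        · rcases ha with rfl | ha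
          · exact hyY h
          · exact hAY a ha.2 h
      · rw [Finset.card_insert_of_notMem fun h => hyA (Finset.mem_of_mem_erase h),
          Finset.card_erase_of_mem hzA]
        lia
    · refine ihH _ (SimpleGraph.deleteIncidenceSet_lt hyz.symm) _ A (hH.mono hdelz)
        (hisolated z) ?_ (hA.anti hdelz subset_rfl) hd
      rintro a ha (rfl | h)
      · exact hzA ha
      · exact hAY a ha h

end ForestDepth

section Whisker

open Finsupp (single)

variable {n : ℕ}

/-- The whisker graph of `G`: the vertex `inr i` is attached as a leaf to `inl i`. -/
def SimpleGraph.whisker (G : SimpleGraph (Fin n)) : SimpleGraph (Fin n ⊕ Fin n) where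
  Adj
    | .inl i, .inl j => G.Adj i j
    | .inl i, .inr j => i = j
    | .inr i, .inl j => i = j
    | .inr _, .inr _ => False
  symm := ⟨by
    rintro (i | i) (j | j) h
    exacts [SimpleGraph.Adj.symm h, Eq.symm h, Eq.symm h, h]⟩
  loopless := ⟨by
    rintro (i | i) h
    exacts [G.loopless.irrefl i h, h]⟩

theorem SimpleGraph.IsRootedForest.whisker {G : SimpleGraph (Fin n)} {δ : Fin n → ℕ}
    (h : G.IsRootedForest δ) :
    G.whisker.IsRootedForest (Sum.elim δ fun i => δ i + 1) where
  height_ne := by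
    rintro (i | i) (j | j) hij
    · exact h.height_ne hij
    · obtain rfl : i = j := hij
      simp
    · obtain rfl : i = j := hij
      simp
    · exact hij.elim
  parent_unique := by
    rintro (i | i) (j | j) (l | l) hij hil hj hl
    · exact congrArg Sum.inl (h.parent_unique hij hil hj hl)
    · obtain rfl : i = l := hil
      simp at hl
    · obtain rfl : i = j := hij
      simp at hj
    · obtain rfl : i = j := hij
      simp at hj
    · exact congrArg Sum.inl ((Eq.symm hij).trans hil)
    · exact hil.elim
    · exact hij.elim
    · exact hij.elim

theorem SimpleGraph.isNeighborPacking_whisker (G : SimpleGraph (Fin n)) :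
    G.whisker.IsNeighborPacking (Finset.univ.map Function.Embedding.inr) := by
  intro a ha b hb v hva hvb
  obtain ⟨i, -, rfl⟩ := Finset.mem_map.mp ha
  obtain ⟨j, -, rfl⟩ := Finset.mem_map.mp hb
  rcases v with l | l
  · rcases hva with hva | hva
    · cases hva
    rcases hvb with hvb | hvb
    · cases hvb
    exact congrArg Sum.inr ((Eq.symm hva).trans hvb)
  · rcases hva with hva | hva
    · rcases hvb with hvb | hvb
      · exact hva.symm.trans hvb
      · exact hvb.elim
    · exact hva.elim

variable (K : Type*) [Field K]

theorem whiskerEdgeIdeal_eq_span (G : SimpleGraph (Fin n)) :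
    whiskerEdgeIdeal K G =
      Ideal.span {p | ∃ a b, G.whisker.Adj a b ∧ p = monomial (single a 1 + single b 1) 1} := by
  have hX : ∀ a b : Fin n ⊕ Fin n,
      (monomial (single a 1 + single b 1) 1 : MvPolynomial _ K) = X a * X b := fun a b => by
    rw [X, X, monomial_mul, one_mul]
  simp only [hX]
  refine le_antisymm (Ideal.span_mono ?_) (Ideal.span_le.mpr ?_)
  · rintro p (⟨i, j, hij, rfl⟩ | ⟨i, rfl⟩)
    · exact ⟨Sum.inl i, Sum.inl j, hij, rfl⟩
    · exact ⟨Sum.inl i, Sum.inr i, rfl, rfl⟩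
  · rintro p ⟨i | i, j | j, hij, rfl⟩
    · exact Ideal.subset_span (Or.inl ⟨i, j, hij, rfl⟩)
    · obtain rfl : i = j := hij
      exact Ideal.subset_span (Or.inr ⟨i, rfl⟩)
    · obtain rfl : i = j := hij
      exact Ideal.subset_span (Or.inr ⟨i, mul_comm _ _⟩)
    · exact hij.elim

theorem whiskerEdgeIdeal_pow (G : SimpleGraph (Fin n)) (k : ℕ) :
    whiskerEdgeIdeal K G ^ k = monIdeal K (edgePow G.whisker k) := by
  induction k with
  | zero =>
    rw [pow_zero, Ideal.one_eq_top, eq_comm, Ideal.eq_top_iff_one]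
    exact Ideal.subset_span ⟨0, trivial, rfl⟩
  | succ k ih =>
    rw [pow_succ', ih, whiskerEdgeIdeal_eq_span, monIdeal, Ideal.span_mul_span', monIdeal]
    congr 1
    ext p
    constructor
    · rintro ⟨_, ⟨a, b, hab, rfl⟩, _, ⟨s, hs, rfl⟩, rfl⟩
      exact ⟨_, ⟨a, b, hab, s, hs, rfl⟩, by simp [monomial_mul, add_assoc]⟩
    · rintro ⟨_, ⟨a, b, hab, s, hs, rfl⟩, rfl⟩
      exact ⟨_, ⟨a, b, hab, rfl⟩, _, ⟨s, hs, rfl⟩, by simp [monomial_mul, add_assoc]⟩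

theorem whiskerEdgeIdeal_le_maxIdeal (G : SimpleGraph (Fin n)) :
    whiskerEdgeIdeal K G ≤ maxIdeal (Fin n ⊕ Fin n) K := by
  refine Ideal.span_le.mpr ?_
  rintro p (⟨i, j, -, rfl⟩ | ⟨i, rfl⟩) <;>
    exact Ideal.mul_mem_right _ _ (Ideal.subset_span ⟨_, rfl⟩)

theorem maxIdeal_ne_top (σ : Type*) : maxIdeal σ K ≠ ⊤ := by
  intro h
  have hle : maxIdeal σ K ≤ RingHom.ker (constantCoeff (σ := σ) (R := K)) := by
    refine Ideal.span_le.mpr ?_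
    rintro _ ⟨x, rfl⟩
    simp
  have h1 : (1 : MvPolynomial σ K) ∈ maxIdeal σ K := h ▸ Submodule.mem_top
  simpa using hle h1

/-- A weakly regular sequence inside a proper ideal containing `J` is regular on `R / J`. -/
theorem RingTheory.Sequence.IsWeaklyRegular.isRegular_quotient {R : Type*} [CommRing R]
    {J m : Ideal R} (hm : m ≠ ⊤) (hJ : J ≤ m) {rs : List R} (hrs : ∀ r ∈ rs, r ∈ m)
    (h : IsWeaklyRegular (R ⧸ J) rs) : IsRegular (R ⧸ J) rs := by
  refine ⟨h, fun htop => hm ((Ideal.eq_top_iff_one m).mpr ?_)⟩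
  have hle : Ideal.ofList rs • (⊤ : Submodule R (R ⧸ J)) ≤ Submodule.map J.mkQ m := by
    refine Submodule.smul_le.mpr fun r hr x _ => ?_
    obtain ⟨g, rfl⟩ := Submodule.Quotient.mk_surjective J x
    exact ⟨r * g, m.mul_mem_right g ((Ideal.span_le (I := m)).mpr hrs hr), rfl⟩
  obtain ⟨g, hg, hg1⟩ := hle (htop ▸ Submodule.mem_top : Submodule.Quotient.mk (1 : R) ∈ _)
  have hsub := (Submodule.Quotient.eq J).mp hg1
  simpa using m.sub_mem hg (hJ hsub)

end Whisker

/-- Herzog–Hibi–Qureshi, Theorem (tree): if `G` is a forest on `n` vertices, then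
`depth(S*/I(G*)^k) ≥ n - k + 1` for `k = 1, …, n`. -/
theorem depth_whisker_power_ge_of_forest {n : ℕ} (K : Type*) [Field K]
    (G : SimpleGraph (Fin n)) (hG : G.IsAcyclic) (k : ℕ) (hk1 : 1 ≤ k) (hkn : k ≤ n) :
    n - k + 1 ≤ idealDepth (maxIdeal (Fin n ⊕ Fin n) K)
      (MvPolynomial (Fin n ⊕ Fin n) K ⧸ (whiskerEdgeIdeal K G) ^ k) := by
  obtain ⟨δ, hδ⟩ := hG.exists_isRootedForest
  have hdepth : MonDepthGE K (n - k + 1) (edgePowSup G.whisker k ∅) :=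
    monDepthGE_edgePowSup K k ∅ G.whisker _ hδ.whisker (by simp) (by simp)
      G.isNeighborPacking_whisker (by simp; lia)
  have hempty : edgePowSup G.whisker k ∅ = edgePow G.whisker k := by
    simp [edgePowSup]
  unfold MonDepthGE at hdepth
  rw [hempty, ← whiskerEdgeIdeal_pow] at hdepth
  obtain ⟨rs, hlen, hmem, hrs⟩ := hdepth.exists_isWeaklyRegular
  refine le_csSup ⟨2 * n, ?_⟩ ⟨rs, hlen, hmem, hrs.isRegular_quotient (maxIdeal_ne_top K _)
    ((Ideal.pow_le_self (by lia)).trans (whiskerEdgeIdeal_le_maxIdeal K G)) hmem⟩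
  rintro _ ⟨rs, rfl, -, hreg⟩
  have hle := hreg.length_le_ringKrullDim
  rw [MvPolynomial.ringKrullDim_of_isNoetherianRing, ringKrullDim_eq_zero_of_field, zero_add] at hle
  have hle' : rs.length ≤ Nat.card (Fin n ⊕ Fin n) := by exact_mod_cast hle
  simp at hle'
  lia
end
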